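/- Let n, N_G, d_ℓ, d_k, N_k be positive integers, let Q_ℓ ∈ ℝ^{n×d_ℓ} and Q_k ∈ ℝ^{n×d_k} be matrices with orthonormal columns, and let L_1, …, L_{N_G} ∈ ℝ^{n×n} be fixed matrices. Let v be a random vector uniformly distributed on the unit sphere S^{d_ℓ−1} ⊂ ℝ^{d_ℓ}, and let a_1, …, a_{N_k} be i.i.d. random vectors uniformly distributed on the unit sphere S^{d_k−1} ⊂ ℝ^{d_k}, independent of v. For 1 ≤ j ≤ N_k and 1 ≤ g ≤ N_G set ξ_{j,g} = a_jᵀ Q_kᵀ L_gᵀ Q_ℓ v. Then for every Δ > 0 and t > 0, with probability at least 1 − (4 N_G / ((N_k + 1) Δ²)) e^{−2t}, it holds that max_{1≤j≤N_k} √(∑_{g=1}^{N_G} ξ_{j,g}²) ≤ 4 (log(N_k + 1) + log Δ + t) · √(∑_{g=1}^{N_G} ‖Q_kᵀ L_gᵀ Q_ℓ‖_F²) / (√(d_ℓ) √(d_k)). -/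

import Mathlib

open Matrix MeasureTheory

/-- The squared Frobenius norm of a matrix. -/
noncomputable def frobSq {p q : ℕ} (M : Matrix (Fin p) (Fin q) ℝ) : ℝ :=
  ∑ r, ∑ s, (M r s) ^ 2

/-- A probability measure on `ℝ^d` is "uniform on the unit sphere" iff it is supported on the
unit sphere and invariant under every orthogonal transformation of `ℝ^d`. -/
def IsUniformOnSphere {d : ℕ} (P : Measure (EuclideanSpace ℝ (Fin d))) : Prop :=
  IsProbabilityMeasure P ∧
    P (Metric.sphere (0 : EuclideanSpace ℝ (Fin d)) 1)ᶜ = 0 ∧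
    ∀ R : EuclideanSpace ℝ (Fin d) ≃ₗᵢ[ℝ] EuclideanSpace ℝ (Fin d), P.map R = P

open ProbabilityTheory
open scoped ENNReal Nat

lemma gauss_moment (p : ℕ) :
    ∫⁻ x, ENNReal.ofReal (x ^ (2 * p)) ∂(gaussianReal 0 1) = ((2 * p - 1)‼ : ℕ) := by
  have hintegrable : Integrable (fun x : ℝ => x ^ (2 * p)) (gaussianReal 0 1) := by
    have h := (memLp_id_gaussianReal (μ := 0) (v := 1) (2 * p : ℕ)).integrable_norm_pow'
    refine h.congr (Filter.Eventually.of_forall fun x => ?_)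
    simp [pow_mul]
  rw [← ofReal_integral_eq_lintegral_ofReal hintegrable
    (Filter.Eventually.of_forall fun x => (even_two_mul p).pow_nonneg x)]
  rw [integral_gaussianReal_eq_integral_smul one_ne_zero]
  have h1 : (fun x : ℝ => gaussianPDFReal 0 1 x • x ^ (2 * p)) =
      fun x => (√(2 * Real.pi))⁻¹ * ((fun y : ℝ => y ^ (2 * p) * Real.exp (-(1/2) * y ^ 2)) |x|) := by
    ext x
    simp only [gaussianPDFReal, smul_eq_mul, (even_two_mul p).pow_abs, sq_abs]
    simp
    ring_nf
  rw [h1, integral_const_mul,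
    integral_comp_abs (f := fun y : ℝ => y ^ (2 * p) * Real.exp (-(1/2) * y ^ 2))]
  have h2 : ∫ x in Set.Ioi (0:ℝ), x ^ (2 * p) * Real.exp (-(1/2) * x ^ 2) =
      ∫ x in Set.Ioi (0:ℝ), x ^ ((2 * p : ℕ) : ℝ) * Real.exp (-(1/2) * x ^ (2:ℝ)) := by
    norm_cast
  rw [h2, integral_rpow_mul_exp_neg_mul_rpow (by norm_num)
    (by have : (0:ℝ) ≤ ((2 * p : ℕ) : ℝ) := Nat.cast_nonneg _
        linarith) (by norm_num)]
  have h3 : (((2 * p : ℕ) : ℝ) + 1) / 2 = p + 1 / 2 := by push_cast; ring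
  rw [h3, Real.Gamma_nat_add_half]
  rw [← ENNReal.ofReal_natCast]
  congr 1
  have h4 : (1 / 2 : ℝ) ^ (-(((2 * p : ℕ) : ℝ) + 1) / 2) = 2 ^ p * √2 := by
    rw [neg_div, h3, Real.rpow_neg (by norm_num), ← Real.inv_rpow (by norm_num),
      Real.rpow_add (by norm_num), Real.rpow_natCast, Real.sqrt_eq_rpow]
    norm_num
  rw [h4, Real.sqrt_mul (by norm_num)]
  have := Real.sqrt_pos.2 Real.pi_pos
  field_simp

lemma stdG_inner {d : ℕ} (u : EuclideanSpace ℝ (Fin d)) (hu : ‖u‖ = 1) :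
    (stdGaussian (EuclideanSpace ℝ (Fin d))).map (fun g => inner ℝ u g) = gaussianReal 0 1 := by
  have h := IsGaussian.map_eq_gaussianReal (μ := stdGaussian (EuclideanSpace ℝ (Fin d)))
    (innerSL ℝ u)
  rw [variance_dual_stdGaussian, integral_strongDual_stdGaussian] at h
  simpa [hu] using h

lemma stdG_moment {d : ℕ} (u : EuclideanSpace ℝ (Fin d)) (hu : ‖u‖ = 1) (p : ℕ) :
    ∫⁻ g, ENNReal.ofReal ((inner ℝ u g) ^ (2 * p)) ∂(stdGaussian (EuclideanSpace ℝ (Fin d))) =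
      ((2 * p - 1)‼ : ℕ) := by
  rw [← gauss_moment, ← stdG_inner u hu, lintegral_map (by fun_prop) (by fun_prop)]

lemma stdG_norm_sq {d : ℕ} :
    ∫⁻ g, ENNReal.ofReal (‖g‖ ^ 2) ∂(stdGaussian (EuclideanSpace ℝ (Fin d))) = d := by
  have h : ∀ g : EuclideanSpace ℝ (Fin d), ENNReal.ofReal (‖g‖ ^ 2) =
      ∑ i, ENNReal.ofReal ((inner ℝ (EuclideanSpace.single i (1:ℝ)) g) ^ (2 * 1)) := by
    intro g
    rw [← ENNReal.ofReal_sum_of_nonneg (fun i _ => (even_two_mul 1).pow_nonneg _),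
      EuclideanSpace.norm_sq_eq]
    simp [EuclideanSpace.inner_single_left]
  simp_rw [h]
  rw [lintegral_finsetSum _ (fun i _ => by fun_prop)]
  rw [Finset.sum_congr rfl (fun i _ => stdG_moment _ (by simp) 1)]
  simp

lemma lint_pow_le {α : Type*} [MeasurableSpace α] (μ : Measure α) [IsProbabilityMeasure μ]
    (f : α → ℝ≥0∞) (hf : AEMeasurable f μ) (p : ℕ) :
    (∫⁻ x, f x ∂μ) ^ p ≤ ∫⁻ x, f x ^ p ∂μ := by
  rcases Nat.eq_zero_or_pos p with rfl | hp
  · simp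
  rcases eq_or_lt_of_le (Nat.succ_le_of_lt hp) with h1 | h1
  · simp [← h1]
  have h2 := ENNReal.lintegral_mul_le_Lp_mul_Lq μ
    (Real.HolderConjugate.conjExponent (p := p) (by exact_mod_cast h1)) hf
    (aemeasurable_const (b := (1:ℝ≥0∞)))
  simp only [Pi.mul_apply, mul_one, ENNReal.one_rpow, lintegral_const, measure_univ,
    ENNReal.rpow_natCast] at h2
  calc (∫⁻ x, f x ∂μ) ^ p ≤ ((∫⁻ x, f x ^ p ∂μ) ^ (1 / (p:ℝ))) ^ p := by gcongr
    _ = _ := by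
      rw [← ENNReal.rpow_natCast, ← ENNReal.rpow_mul, one_div, inv_mul_cancel₀ (by positivity),
        ENNReal.rpow_one]

lemma sphere_rot {d : ℕ} {P : Measure (EuclideanSpace ℝ (Fin d))} (hP : IsUniformOnSphere P)
    (u w : EuclideanSpace ℝ (Fin d)) (h : ‖u‖ = ‖w‖) (p : ℕ) :
    ∫⁻ a, ENNReal.ofReal ((inner ℝ a u) ^ (2 * p)) ∂P =
      ∫⁻ a, ENNReal.ofReal ((inner ℝ a w) ^ (2 * p)) ∂P := by
  set R := (ℝ ∙ (u - w))ᗮ.reflection with hR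
  have hRu : R u = w := Submodule.reflection_sub h
  conv_rhs => rw [← hP.2.2 R]
  rw [lintegral_map (by fun_prop) (by fun_prop)]
  rw [← hRu]
  simp [LinearIsometryEquiv.inner_map_map]

lemma sphere_moment {d : ℕ} (hd : 0 < d) {P : Measure (EuclideanSpace ℝ (Fin d))}
    (hP : IsUniformOnSphere P) (p : ℕ) (u : EuclideanSpace ℝ (Fin d)) :
    ∫⁻ a, ENNReal.ofReal ((inner ℝ a u) ^ (2 * p)) ∂P ≤
      ENNReal.ofReal (‖u‖ ^ (2 * p) * (((2 * p - 1)‼ : ℕ) / (d:ℝ) ^ p)) := by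
  have := hP.1
  set e : EuclideanSpace ℝ (Fin d) := EuclideanSpace.single ⟨0, hd⟩ (1:ℝ) with he
  set C := ∫⁻ a, ENNReal.ofReal ((inner ℝ a e) ^ (2 * p)) ∂P with hC
  have key : ∀ u : EuclideanSpace ℝ (Fin d), ∫⁻ a, ENNReal.ofReal ((inner ℝ a u) ^ (2 * p)) ∂P =
      ENNReal.ofReal (‖u‖ ^ 2) ^ p * C := by
    intro u
    rw [sphere_rot hP u (‖u‖ • e) (by simp [norm_smul, he]) p, hC, ← lintegral_const_mul _ (by fun_prop)]
    congr 1; ext a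
    rw [inner_smul_right, mul_pow, ENNReal.ofReal_mul (by positivity), pow_mul,
      ENNReal.ofReal_pow (by positivity)]
  have hswap : ∫⁻ g, ∫⁻ a, ENNReal.ofReal ((inner ℝ a g) ^ (2 * p)) ∂P
      ∂(stdGaussian (EuclideanSpace ℝ (Fin d))) = ((2 * p - 1)‼ : ℕ) := by
    rw [lintegral_lintegral_swap (by fun_prop)]
    have : ∀ᵐ a ∂P, ∫⁻ g, ENNReal.ofReal ((inner ℝ a g) ^ (2 * p))
        ∂(stdGaussian (EuclideanSpace ℝ (Fin d))) = ((2 * p - 1)‼ : ℕ) := by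
      have h0 : ∀ᵐ a ∂P, a ∈ Metric.sphere (0 : EuclideanSpace ℝ (Fin d)) 1 := hP.2.1
      filter_upwards [h0] with a ha
      exact stdG_moment a (by simpa using ha) p
    rw [lintegral_congr_ae this]
    simp
  simp_rw [key] at hswap
  rw [lintegral_mul_const _ (by fun_prop)] at hswap
  have hJ := lint_pow_le (stdGaussian (EuclideanSpace ℝ (Fin d)))
    (fun g => ENNReal.ofReal (‖g‖ ^ 2)) (by fun_prop) p
  rw [stdG_norm_sq] at hJ
  have hle : (d:ℝ≥0∞) ^ p * C ≤ ((2 * p - 1)‼ : ℕ) := by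
    rw [← hswap]; gcongr
  have hCle : C ≤ ENNReal.ofReal (((2 * p - 1)‼ : ℕ) / (d:ℝ) ^ p) := by
    rw [ENNReal.ofReal_div_of_pos (by positivity), ENNReal.ofReal_natCast,
      ENNReal.ofReal_pow (by positivity), ENNReal.ofReal_natCast,
      ENNReal.le_div_iff_mul_le (by left; simp [hd.ne']) (by left; simp), mul_comm]
    exact hle
  rw [key, ENNReal.ofReal_mul (by positivity), pow_mul, ENNReal.ofReal_pow (sq_nonneg _)]
  gcongr

lemma sum_pow_conv {ι : Type*} [Fintype ι] (w x : ι → ℝ) (hw : ∀ i, 0 ≤ w i)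
    (hx : ∀ i, 0 ≤ x i) (hW : 0 < ∑ i, w i) (p : ℕ) :
    (∑ i, w i * x i) ^ p ≤ (∑ i, w i) ^ p * ∑ i, (w i / ∑ i, w i) * x i ^ p := by
  have h := Real.pow_arith_mean_le_arith_mean_pow Finset.univ (fun i => w i / ∑ i, w i) x
    (fun i _ => div_nonneg (hw i) hW.le) (by rw [← Finset.sum_div, div_self hW.ne'])
    (fun i _ => hx i) p
  calc (∑ i, w i * x i) ^ p = (∑ i, w i) ^ p * (∑ i, (w i / ∑ i, w i) * x i) ^ p := by
        rw [← mul_pow]; congr 1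
        rw [Finset.mul_sum]
        refine Finset.sum_congr rfl fun i _ => ?_
        field_simp
    _ ≤ _ := by gcongr

lemma sphere_family {d : ℕ} (hd : 0 < d) {P : Measure (EuclideanSpace ℝ (Fin d))}
    (hP : IsUniformOnSphere P) (p : ℕ) {ι : Type*} [Fintype ι]
    (u : ι → EuclideanSpace ℝ (Fin d)) :
    ∫⁻ a, ENNReal.ofReal ((∑ i, (inner ℝ a (u i)) ^ 2) ^ p) ∂P ≤
      ENNReal.ofReal ((∑ i, ‖u i‖ ^ 2) ^ p * (((2 * p - 1)‼ : ℕ) / (d:ℝ) ^ p)) := by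
  have := hP.1
  rcases Nat.eq_zero_or_pos p with rfl | hp
  · simp
  set W := ∑ i, ‖u i‖ ^ 2 with hWdef
  have hW0 : 0 ≤ W := Finset.sum_nonneg fun i _ => by positivity
  set K : ℝ := ((2 * p - 1)‼ : ℕ) / (d:ℝ) ^ p with hK
  have hK0 : 0 ≤ K := by positivity
  rcases hW0.eq_or_lt with hW | hW
  · have hz : ∀ i, u i = 0 := by
      intro i
      have := (Finset.sum_eq_zero_iff_of_nonneg (fun i _ => by positivity)).1 hW.symm i
        (Finset.mem_univ i)
      simpa using this
    simp [hz, hp.ne']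
  have hpt : ∀ a, (∑ i, (inner ℝ a (u i)) ^ 2) ^ p ≤
      W ^ p * ∑ i, (‖u i‖ ^ 2 / W) * (inner ℝ a (‖u i‖⁻¹ • u i)) ^ (2 * p) := by
    intro a
    have h := sum_pow_conv (fun i => ‖u i‖ ^ 2) (fun i => (inner ℝ a (‖u i‖⁻¹ • u i)) ^ 2)
      (fun i => by positivity) (fun i => by positivity) hW p
    simp only [← pow_mul] at h
    refine le_trans (le_of_eq ?_) h
    congr 1
    refine Finset.sum_congr rfl fun i _ => ?_
    rw [inner_smul_right]
    by_cases hz : u i = 0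
    · simp [hz]
    · have : ‖u i‖ ≠ 0 := by simpa using hz
      field_simp
  calc _ ≤ ∫⁻ a, ENNReal.ofReal (W ^ p) * ∑ i, ENNReal.ofReal (‖u i‖ ^ 2 / W) *
          ENNReal.ofReal ((inner ℝ a (‖u i‖⁻¹ • u i)) ^ (2 * p)) ∂P := by
        refine lintegral_mono fun a => ?_
        refine (ENNReal.ofReal_le_ofReal (hpt a)).trans (le_of_eq ?_)
        rw [ENNReal.ofReal_mul (by positivity), ENNReal.ofReal_sum_of_nonneg]
        · congr 1
          refine Finset.sum_congr rfl fun i _ => ?_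
          rw [ENNReal.ofReal_mul (by positivity)]
        · intro i _
          have := (even_two_mul p).pow_nonneg (inner ℝ a (‖u i‖⁻¹ • u i))
          positivity
    _ = ENNReal.ofReal (W ^ p) * ∑ i, ENNReal.ofReal (‖u i‖ ^ 2 / W) *
          ∫⁻ a, ENNReal.ofReal ((inner ℝ a (‖u i‖⁻¹ • u i)) ^ (2 * p)) ∂P := by
        rw [lintegral_const_mul _ (by fun_prop), lintegral_finsetSum _ (fun i _ => by fun_prop)]
        congr 1
        refine Finset.sum_congr rfl fun i _ => ?_
        rw [lintegral_const_mul _ (by fun_prop)]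
    _ ≤ ENNReal.ofReal (W ^ p) * ∑ i, ENNReal.ofReal (‖u i‖ ^ 2 / W) * ENNReal.ofReal K := by
        gcongr with i
        refine (sphere_moment hd hP p _).trans (ENNReal.ofReal_le_ofReal ?_)
        refine mul_le_of_le_one_left hK0 (pow_le_one₀ (norm_nonneg _) ?_)
        rw [norm_smul, norm_inv, norm_norm]
        exact inv_mul_le_one
    _ = _ := by
        rw [← Finset.sum_mul, ← ENNReal.ofReal_sum_of_nonneg (fun i _ => by positivity),
          ← Finset.sum_div, div_self hW.ne', ENNReal.ofReal_one, one_mul,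
          ← ENNReal.ofReal_mul (by positivity)]

lemma df_le (n : ℕ) : n‼ ≤ (n + 1)‼ := by
  induction n using Nat.strong_induction_on with
  | _ n ih =>
    match n with
    | 0 => simp
    | 1 => simp [Nat.doubleFactorial]
    | k + 2 =>
      have h := ih k (by omega)
      rw [Nat.doubleFactorial_add_two, show k + 2 + 1 = (k + 1) + 2 by omega,
        Nat.doubleFactorial_add_two]
      exact Nat.mul_le_mul (by omega) h

/-- The squared quantity whose square root is bounded. -/
noncomputable def TT {dl dk NG : ℕ} (M : Fin NG → Matrix (Fin dk) (Fin dl) ℝ)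
    (z : EuclideanSpace ℝ (Fin dl) × EuclideanSpace ℝ (Fin dk)) : ℝ :=
  ∑ g, (z.2 ⬝ᵥ (M g *ᵥ z.1)) ^ 2

lemma TT_nonneg {dl dk NG : ℕ} (M : Fin NG → Matrix (Fin dk) (Fin dl) ℝ)
    (z : EuclideanSpace ℝ (Fin dl) × EuclideanSpace ℝ (Fin dk)) : 0 ≤ TT M z :=
  Finset.sum_nonneg fun _ _ => by positivity

lemma TT_meas {dl dk NG : ℕ} (M : Fin NG → Matrix (Fin dk) (Fin dl) ℝ) : Measurable (TT M) := by
  unfold TT dotProduct mulVec dotProduct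
  fun_prop

lemma TT_moment {dl dk NG : ℕ} (hdl : 0 < dl) (hdk : 0 < dk)
    (M : Fin NG → Matrix (Fin dk) (Fin dl) ℝ)
    {Pl : Measure (EuclideanSpace ℝ (Fin dl))} {Pk : Measure (EuclideanSpace ℝ (Fin dk))}
    (hPl : IsUniformOnSphere Pl) (hPk : IsUniformOnSphere Pk) (p : ℕ) :
    ∫⁻ z, ENNReal.ofReal (TT M z ^ p) ∂(Pl.prod Pk) ≤
      ENNReal.ofReal (((∑ g, frobSq (M g)) / (dl * dk)) ^ p * (2 * p)!) := by
  have := hPl.1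
  have := hPk.1
  rw [lintegral_prod _ ((TT_meas M).pow_const p).ennreal_ofReal.aemeasurable]
  have h1 : ∀ x, ∫⁻ y, ENNReal.ofReal (TT M (x, y) ^ p) ∂Pk ≤
      ENNReal.ofReal ((∑ i : Fin NG × Fin dk,
        (inner ℝ x (WithLp.toLp 2 (M i.1 i.2))) ^ 2) ^ p) *
        ENNReal.ofReal (((2 * p - 1)‼ : ℕ) / (dk:ℝ) ^ p) := by
    intro x
    have h := sphere_family hdk hPk p (fun g => WithLp.toLp 2 (M g *ᵥ x))
    rw [← ENNReal.ofReal_mul (by positivity)]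
    refine le_trans (le_of_eq ?_) (h.trans (le_of_eq ?_))
    · congr 1; ext y; congr 2
      unfold TT
      refine Finset.sum_congr rfl fun g _ => ?_
      congr 1
      simp [PiLp.inner_apply, dotProduct, mul_comm]
    · congr 3
      rw [Fintype.sum_prod_type]
      refine Finset.sum_congr rfl fun g _ => ?_
      rw [EuclideanSpace.norm_sq_eq]
      refine Finset.sum_congr rfl fun r _ => ?_
      simp [PiLp.inner_apply, mulVec, dotProduct]
  refine (lintegral_mono h1).trans ?_
  rw [lintegral_mul_const _ (by fun_prop)]
  refine (mul_le_mul_left (sphere_family hdl hPl p _) _).trans ?_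
  rw [← ENNReal.ofReal_mul (by positivity)]
  refine ENNReal.ofReal_le_ofReal ?_
  have hS : ∑ i : Fin NG × Fin dk, ‖(WithLp.toLp 2 (M i.1 i.2) : EuclideanSpace ℝ (Fin dl))‖ ^ 2
      = ∑ g, frobSq (M g) := by
    rw [Fintype.sum_prod_type]
    simp [frobSq, EuclideanSpace.norm_sq_eq]
  rw [hS]
  have hS0 : 0 ≤ ∑ g, frobSq (M g) := by rw [← hS]; positivity
  have hdf : (((2 * p - 1)‼ : ℕ) : ℝ) * ((2 * p - 1)‼ : ℕ) ≤ ((2 * p)! : ℕ) := by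
    rcases p with _ | p
    · simp
    · have e1 : 2 * (p + 1) - 1 = 2 * p + 1 := by omega
      have e2 : 2 * (p + 1) = (2 * p + 1) + 1 := by omega
      rw [e1, e2, Nat.factorial_eq_mul_doubleFactorial]
      norm_cast
      exact Nat.mul_le_mul_right _ (df_le _)
  calc _ = ((∑ g, frobSq (M g)) / (dl * dk)) ^ p *
        ((((2 * p - 1)‼ : ℕ) : ℝ) * ((2 * p - 1)‼ : ℕ)) := by
        rw [div_pow, mul_pow]; field_simp
    _ ≤ _ := by gcongr

lemma TT_tail {dl dk NG : ℕ} (hdl : 0 < dl) (hdk : 0 < dk)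
    (M : Fin NG → Matrix (Fin dk) (Fin dl) ℝ)
    {Pl : Measure (EuclideanSpace ℝ (Fin dl))} {Pk : Measure (EuclideanSpace ℝ (Fin dk))}
    (hPl : IsUniformOnSphere Pl) (hPk : IsUniformOnSphere Pk) (s : ℝ) (hs : 0 ≤ s) :
    (Pl.prod Pk) {z | 4 * s * √(∑ g, frobSq (M g)) / (√dl * √dk) < √(TT M z)} ≤
      ENNReal.ofReal (4 * Real.exp (-2 * s)) := by
  have hS0 : 0 ≤ ∑ g, frobSq (M g) := by unfold frobSq; positivity
  rcases hS0.eq_or_lt with hS | hS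
  · have hM : ∀ g r c, M g r c = 0 := by
      intro g r c
      have h1 := (Finset.sum_eq_zero_iff_of_nonneg
        (fun i _ => by unfold frobSq; positivity)).1 hS.symm g (Finset.mem_univ _)
      have h2 := (Finset.sum_eq_zero_iff_of_nonneg
        (fun i _ => by positivity)).1 h1 r (Finset.mem_univ _)
      have h3 := (Finset.sum_eq_zero_iff_of_nonneg
        (fun i _ => by positivity)).1 h2 c (Finset.mem_univ _)
      simpa using h3
    have hT : ∀ z, TT M z = 0 := by
      intro z
      simp [TT, dotProduct, mulVec, hM]
    simp [hT, ← hS]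
  set σ := (∑ g, frobSq (M g)) / (dl * dk) with hσ
  have hσ0 : 0 < σ := by positivity
  have hsq : √σ = √(∑ g, frobSq (M g)) / (√dl * √dk) := by
    rw [hσ, Real.sqrt_div hS0, Real.sqrt_mul (by positivity)]
  have hsσ : 0 < √σ := Real.sqrt_pos.2 hσ0
  have hcosh : ∀ z, ENNReal.ofReal (Real.cosh (√(TT M z) / (2 * √σ))) =
      ∑' p : ℕ, ENNReal.ofReal ((4 * σ)⁻¹ ^ p / (2 * p)!) * ENNReal.ofReal (TT M z ^ p) := by
    intro z
    have h := Real.hasSum_cosh (√(TT M z) / (2 * √σ))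
    rw [← h.tsum_eq, ENNReal.ofReal_tsum_of_nonneg _ h.summable]
    · refine tsum_congr fun p => ?_
      rw [← ENNReal.ofReal_mul (by positivity)]
      congr 1
      rw [pow_mul, div_pow, mul_pow, Real.sq_sqrt (TT_nonneg M z), Real.sq_sqrt hσ0.le, div_pow,
        inv_pow]
      norm_num
      ring
    · intro p
      positivity
  have hE : ∫⁻ z, ENNReal.ofReal (Real.cosh (√(TT M z) / (2 * √σ))) ∂(Pl.prod Pk) ≤
      ENNReal.ofReal (4 / 3) := by
    simp_rw [hcosh]
    rw [lintegral_tsum (fun p => ((TT_meas M).pow_const p).ennreal_ofReal.aemeasurable.const_mul _)]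
    have hg : HasSum (fun p : ℕ => (1/4 : ℝ) ^ p) (4/3) := by
      have := hasSum_geometric_of_lt_one (r := (1/4 : ℝ)) (by norm_num) (by norm_num)
      norm_num at this ⊢
      exact this
    rw [← hg.tsum_eq, ENNReal.ofReal_tsum_of_nonneg (fun p => by positivity) hg.summable]
    refine ENNReal.tsum_le_tsum fun p => ?_
    rw [lintegral_const_mul _ ((TT_meas M).pow_const p).ennreal_ofReal]
    refine (mul_le_mul_right (TT_moment hdl hdk M hPl hPk p) _).trans ?_
    rw [← ENNReal.ofReal_mul (by positivity)]
    refine ENNReal.ofReal_le_ofReal (le_of_eq ?_)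
    rw [← hσ]
    have : ((2 * p)! : ℝ) ≠ 0 := by positivity
    rw [inv_pow, mul_pow, one_div, inv_pow]
    field_simp
  have hMk := mul_meas_ge_le_lintegral (μ := Pl.prod Pk)
    (f := fun z => ENNReal.ofReal (Real.cosh (√(TT M z) / (2 * √σ))))
    (by have := TT_meas M
        have h2 : Measurable Real.cosh := Real.continuous_cosh.measurable
        fun_prop) (ENNReal.ofReal (Real.cosh (2 * s)))
  have hsub : {z | 4 * s * √(∑ g, frobSq (M g)) / (√dl * √dk) < √(TT M z)} ⊆
      {z | ENNReal.ofReal (Real.cosh (2 * s)) ≤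
        ENNReal.ofReal (Real.cosh (√(TT M z) / (2 * √σ)))} := by
    intro z hz
    simp only [Set.mem_ofPred_eq] at hz ⊢
    refine ENNReal.ofReal_le_ofReal (Real.cosh_le_cosh.2 ?_)
    rw [abs_of_nonneg (by positivity), abs_of_nonneg (by positivity), le_div_iff₀ (by positivity)]
    rw [mul_div_assoc, ← hsq] at hz
    linarith
  refine (measure_mono hsub).trans ?_
  have hc : 0 < Real.cosh (2 * s) := Real.cosh_pos _
  have h3 := hMk.trans hE
  rw [mul_comm, ← ENNReal.le_div_iff_mul_le (by left; simpa using hc) (by left; simp),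
    ← ENNReal.ofReal_div_of_pos hc] at h3
  refine h3.trans (ENNReal.ofReal_le_ofReal ?_)
  rw [div_le_iff₀ hc, Real.cosh_eq, neg_mul, Real.exp_neg]
  have := Real.exp_pos (2 * s)
  have h4 : (Real.exp (2 * s))⁻¹ * Real.exp (2 * s) = 1 := inv_mul_cancel₀ this.ne'
  have h6 : 0 < (Real.exp (2 * s))⁻¹ * (Real.exp (2 * s))⁻¹ := by positivity
  nlinarith

/-- Semi-random model bound: if `v` is uniform on `S^{dℓ-1}`, the `a j` are i.i.d. uniform on
`S^{dk-1}` independent of `v`, and `ξ_{j,g} = aⱼᵀ Qkᵀ Lgᵀ Qℓ v`, then with probability at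
least `1 - (4 N_G / ((N_k+1) Δ²)) e^{-2t}`,
`max_j √(∑_g ξ_{j,g}²) ≤ 4 (log(N_k+1) + log Δ + t) √(∑_g ‖Qkᵀ Lgᵀ Qℓ‖_F²) / (√dℓ √dk)`. -/
theorem stmt1 {n NG dl dk Nk : ℕ}
    (hn : 0 < n) (hNG : 0 < NG) (hdl : 0 < dl) (hdk : 0 < dk) (hNk : 0 < Nk)
    (Ql : Matrix (Fin n) (Fin dl) ℝ) (Qk : Matrix (Fin n) (Fin dk) ℝ)
    (hQl : Qlᵀ * Ql = 1) (hQk : Qkᵀ * Qk = 1)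
    (L : Fin NG → Matrix (Fin n) (Fin n) ℝ)
    {Ω : Type*} [MeasurableSpace Ω] (μ : Measure Ω) [IsProbabilityMeasure μ]
    (v : Ω → EuclideanSpace ℝ (Fin dl))
    (a : Fin Nk → Ω → EuclideanSpace ℝ (Fin dk))
    (Pl : Measure (EuclideanSpace ℝ (Fin dl)))
    (Pk : Measure (EuclideanSpace ℝ (Fin dk)))
    (hPl : IsUniformOnSphere Pl) (hPk : IsUniformOnSphere Pk)
    (hmeas : Measurable fun ω => (v ω, fun j => a j ω))
    -- `v` and the `a j` are jointly independent, `v` has law `Pl`, each `a j` has law `Pk`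
    (hlaw : μ.map (fun ω => (v ω, fun j => a j ω)) =
      Pl.prod (Measure.pi fun _ : Fin Nk => Pk))
    (Δ t : ℝ) (hΔ : 0 < Δ) (ht : 0 < t) :
    ENNReal.ofReal (1 - 4 * NG / ((Nk + 1) * Δ ^ 2) * Real.exp (-2 * t)) ≤
      μ {ω | (Finset.univ.sup' ⟨⟨0, hNk⟩, Finset.mem_univ _⟩ fun j : Fin Nk =>
            Real.sqrt (∑ g, ((a j ω) ⬝ᵥ ((Qkᵀ * (L g)ᵀ * Ql) *ᵥ (v ω))) ^ 2)) ≤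
          4 * (Real.log (Nk + 1) + Real.log Δ + t) *
            Real.sqrt (∑ g, frobSq (Qkᵀ * (L g)ᵀ * Ql)) /
              (Real.sqrt dl * Real.sqrt dk)} := by
  set M : Fin NG → Matrix (Fin dk) (Fin dl) ℝ := fun g => Qkᵀ * (L g)ᵀ * Ql with hM
  set X : ℝ := (Nk + 1) * Δ * Real.exp t with hX
  have hX0 : 0 < X := by positivity
  set s : ℝ := Real.log (Nk + 1) + Real.log Δ + t with hs
  have hsX : s = Real.log X := by
    rw [hX, Real.log_mul (by positivity) (by positivity), Real.log_mul (by positivity) hΔ.ne',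
      Real.log_exp]
  have hexp : Real.exp (-2 * s) = (X ^ 2)⁻¹ := by
    rw [hsX, neg_mul, Real.exp_neg, two_mul, Real.exp_add, Real.exp_log hX0, sq]
  have hq : 4 * NG / ((Nk + 1) * Δ ^ 2) * Real.exp (-2 * t) =
      4 * NG * (Nk + 1) * Real.exp (-2 * s) := by
    rw [hexp, hX, neg_mul, Real.exp_neg, two_mul, Real.exp_add]
    field_simp
  rw [hq]
  have hNG1 : (1:ℝ) ≤ NG := by exact_mod_cast hNG
  have hNk1 : (1:ℝ) ≤ Nk := by exact_mod_cast hNk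
  rcases lt_or_ge s 0 with hneg | hs0
  · have h1 : 1 ≤ Real.exp (-2 * s) := Real.one_le_exp (by linarith)
    have h2 : (1:ℝ) ≤ NG * (Nk + 1) := by nlinarith
    rw [ENNReal.ofReal_of_nonpos (by nlinarith)]
    exact zero_le
  set thr : ℝ := 4 * s * √(∑ g, frobSq (M g)) / (√dl * √dk) with hthr
  have hB : ∀ j, μ {ω | thr < √(TT M (v ω, a j ω))} ≤ ENNReal.ofReal (4 * Real.exp (-2 * s)) := by
    intro j
    have := hPl.1
    have := hPk.1
    have hset : MeasurableSet {z | thr < √(TT M z)} :=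
      measurableSet_lt measurable_const (TT_meas M).sqrt
    have hmp : (Pl.prod (Measure.pi fun _ : Fin Nk => Pk)).map
        (Prod.map id (Function.eval j)) = Pl.prod Pk :=
      ((MeasurePreserving.id Pl).prod (measurePreserving_eval (fun _ : Fin Nk => Pk) j)).map_eq
    refine le_trans (le_of_eq ?_) (TT_tail hdl hdk M hPl hPk s hs0)
    rw [← hmp, ← hlaw, Measure.map_map (by fun_prop) hmeas,
      Measure.map_apply (Measurable.comp (by fun_prop) hmeas) hset]
    rfl
  set G := {ω | (Finset.univ.sup' ⟨⟨0, hNk⟩, Finset.mem_univ _⟩ fun j : Fin Nk =>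
            Real.sqrt (∑ g, ((a j ω) ⬝ᵥ ((Qkᵀ * (L g)ᵀ * Ql) *ᵥ (v ω))) ^ 2)) ≤ thr} with hG
  have hGc : Gᶜ = ⋃ j, {ω | thr < √(TT M (v ω, a j ω))} := by
    ext ω
    simp only [hG, TT, hM, Set.mem_compl_iff, Set.mem_ofPred_eq, not_le, Set.mem_iUnion]
    exact (Finset.lt_sup'_iff _).trans (by simp)
  have hGb : μ Gᶜ ≤ ENNReal.ofReal (4 * NG * (Nk + 1) * Real.exp (-2 * s)) := by
    rw [hGc]
    refine (measure_iUnion_le _).trans ?_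
    rw [tsum_fintype]
    refine (Finset.sum_le_sum fun j _ => hB j).trans ?_
    rw [Finset.sum_const, Finset.card_univ, Fintype.card_fin, nsmul_eq_mul,
      ← ENNReal.ofReal_natCast, ← ENNReal.ofReal_mul (by positivity)]
    refine ENNReal.ofReal_le_ofReal ?_
    have := Real.exp_pos (-2 * s)
    have h2 : (Nk:ℝ) ≤ NG * (Nk + 1) := by nlinarith
    nlinarith
  rw [ENNReal.ofReal_sub _ (by positivity), ENNReal.ofReal_one, tsub_le_iff_right]
  calc (1:ℝ≥0∞) = μ (G ∪ Gᶜ) := by simp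
    _ ≤ μ G + μ Gᶜ := measure_union_le _ _
    _ ≤ _ := by gcongr
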